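/- arXiv:2212.14500 — 4 statements merged into one kernel-verified Lean document; each statement's English description precedes it below -/
import Mathlib

section
/- Let J = [t₀, t₀ + a] with a > 0, let g : J → ℝ be nondecreasing and continuous, let f : J × ℝⁿ → ℝⁿ satisfy conditions (A1) and (A2), and let h : J × ℝⁿ → ℝⁿ satisfy condition (A3*) with, in addition, h(·, v) continuous on J for every v ∈ ℝⁿ. Then every solution x : J → ℝⁿ of the hybrid measure differential equation on J with data (h, f, g, x₀) is a continuous function. -/
open Set Filter Topology

namespace HMDEPaper

/-- `ℝⁿ` with the Euclidean norm. -/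
abbrev En (n : ℕ) := EuclideanSpace ℝ (Fin n)

section Defs

variable {E : Type*} [NormedAddCommGroup E]

/-- `f` is regulated on the interval `[a, b]`: one-sided limits exist at every point. -/
def RegulatedOn (f : ℝ → E) (a b : ℝ) : Prop :=
  (∀ t ∈ Set.Ioc a b, ∃ L, Filter.Tendsto f (nhdsWithin t (Set.Ico a t)) (nhds L)) ∧
  (∀ t ∈ Set.Ico a b, ∃ L, Filter.Tendsto f (nhdsWithin t (Set.Ioc t b)) (nhds L))

/-- `f` is regulated on `[0, ∞)`: one-sided limits exist at every point. -/
def RegulatedOnIci (f : ℝ → E) : Prop :=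
  (∀ t : ℝ, 0 < t → ∃ L, Filter.Tendsto f (nhdsWithin t (Set.Ico 0 t)) (nhds L)) ∧
  (∀ t : ℝ, 0 ≤ t → ∃ L, Filter.Tendsto f (nhdsWithin t (Set.Ioi t)) (nhds L))

/-- A family `F` of functions is equiregulated on `[a, b]`. -/
def EquiregulatedOn (F : Set (ℝ → E)) (a b : ℝ) : Prop :=
  ∀ ε : ℝ, 0 < ε →
    (∀ τ ∈ Set.Ioc a b, ∃ δ > (0 : ℝ), ∀ y ∈ F, ∀ L,
      Filter.Tendsto y (nhdsWithin τ (Set.Ico a τ)) (nhds L) →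
      ∀ t ∈ Set.Ico a τ, τ - δ < t → ‖y t - L‖ < ε) ∧
    (∀ τ ∈ Set.Ico a b, ∃ δ > (0 : ℝ), ∀ y ∈ F, ∀ L,
      Filter.Tendsto y (nhdsWithin τ (Set.Ioc τ b)) (nhds L) →
      ∀ t ∈ Set.Ioc τ b, t < τ + δ → ‖y t - L‖ < ε)

/-- A D-function: continuous, nondecreasing on `[0, ∞)`, vanishing at `0`, positive on `(0, ∞)`. -/
def IsDFunction (φ : ℝ → ℝ) : Prop :=
  ContinuousOn φ (Set.Ici 0) ∧ MonotoneOn φ (Set.Ici 0) ∧ φ 0 = 0 ∧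
    ∀ s : ℝ, 0 < s → 0 < φ s

/-- `g` is left-continuous at every point of `(a, b]`. -/
def LeftContinuousOn (g : ℝ → ℝ) (a b : ℝ) : Prop :=
  ∀ t ∈ Set.Ioc a b, Filter.Tendsto g (nhdsWithin t (Set.Ico a t)) (nhds (g t))

/-- A bounded regulated function on `[0, ∞)` which is S-asymptotically `ω`-periodic. -/
def SAsympPeriodic (ω : ℝ) (x : ℝ → E) : Prop :=
  (∃ C : ℝ, ∀ t : ℝ, 0 ≤ t → ‖x t‖ ≤ C) ∧ RegulatedOnIci x ∧
    Filter.Tendsto (fun t => x (t + ω) - x t) Filter.atTop (nhds 0)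

end Defs

section KS

/-- A tagged partition of `[a, b]`. -/
structure TaggedPartition (a b : ℝ) where
  n : ℕ
  npos : 0 < n
  s : ℕ → ℝ
  τ : ℕ → ℝ
  s_first : s 0 = a
  s_last : s n = b
  s_mono : ∀ i < n, s i ≤ s (i + 1)
  tag_mem : ∀ i < n, τ i ∈ Set.Icc (s i) (s (i + 1))

/-- A tagged partition is `δ`-fine for a gauge `δ`. -/
def TaggedPartition.IsFine {a b : ℝ} (P : TaggedPartition a b) (δ : ℝ → ℝ) : Prop :=
  ∀ i < P.n,
    Set.Icc (P.s i) (P.s (i + 1)) ⊆ Set.Ioo (P.τ i - δ (P.τ i)) (P.τ i + δ (P.τ i))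

variable {E : Type*} [NormedAddCommGroup E] [NormedSpace ℝ E]

/-- The Kurzweil–Stieltjes Riemann sum of `f` w.r.t. `g` over a tagged partition. -/
def TaggedPartition.sum {a b : ℝ} (P : TaggedPartition a b) (f : ℝ → E) (g : ℝ → ℝ) : E :=
  ∑ i ∈ Finset.range P.n, (g (P.s (i + 1)) - g (P.s i)) • f (P.τ i)

/-- `I` is the Kurzweil–Stieltjes integral of `f` w.r.t. `g` over `[a, b]`. -/
def HasKSIntegral (f : ℝ → E) (g : ℝ → ℝ) (a b : ℝ) (I : E) : Prop :=
  ∀ ε : ℝ, 0 < ε → ∃ δ : ℝ → ℝ, (∀ t, 0 < δ t) ∧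
    ∀ P : TaggedPartition a b, P.IsFine δ → ‖P.sum f g - I‖ < ε

/-- `f` is Kurzweil–Stieltjes integrable w.r.t. `g` over `[a, b]`. -/
def KSIntegrable (f : ℝ → E) (g : ℝ → ℝ) (a b : ℝ) : Prop :=
  ∃ I, HasKSIntegral f g a b I

/-- A solution of the hybrid measure differential equation on `[t₀, t₀ + a]`
with data `(h, f, g, x₀)`. -/
def IsHMDESolution (h f : ℝ → E → E) (g : ℝ → ℝ) (t₀ a : ℝ) (x₀ : E) (x : ℝ → E) : Prop :=
  RegulatedOn x t₀ (t₀ + a) ∧ x t₀ = x₀ ∧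
  RegulatedOn (fun t => h t (x t)) t₀ (t₀ + a) ∧
  ∃ I : ℝ → E,
    (∀ t ∈ Set.Icc t₀ (t₀ + a), HasKSIntegral (fun s => f s (x s)) g t₀ t (I t)) ∧
    (∀ t ∈ Set.Icc t₀ (t₀ + a), x t = x₀ - h t₀ x₀ + h t (x t) + I t)

end KS

end HMDEPaper

namespace HMDEPaper

namespace TaggedPartition

/-- The partition of `[a, b]` into the single interval `[a, b]` with tag `t`. -/
def single {a b : ℝ} (t : ℝ) (ht : t ∈ Set.Icc a b) : TaggedPartition a b where
  n := 1
  npos := one_pos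
  s i := if i = 0 then a else b
  τ _ := t
  s_first := by simp
  s_last := by simp
  s_mono i hi := by
    obtain rfl : i = 0 := by omega
    simpa using ht.1.trans ht.2
  tag_mem i hi := by
    obtain rfl : i = 0 := by omega
    simpa using ht

/-- Concatenation of tagged partitions of adjacent intervals. -/
def append {a b c : ℝ} (P : TaggedPartition a b) (Q : TaggedPartition b c) :
    TaggedPartition a c where
  n := P.n + Q.n
  npos := Nat.add_pos_left P.npos _
  s i := if i < P.n then P.s i else Q.s (i - P.n)
  τ i := if i < P.n then P.τ i else Q.τ (i - P.n)
  s_first := by simp [P.npos, P.s_first]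
  s_last := by simp [Q.s_last]
  s_mono i hi := by
    rcases lt_trichotomy (i + 1) P.n with h | h | h
    · simpa [h, show i < P.n by omega] using P.s_mono i (by omega)
    · have := P.s_mono i (by omega)
      rw [h, P.s_last] at this
      simpa [h, show i < P.n by omega, Q.s_first] using this
    · have := Q.s_mono (i - P.n) (by omega)
      rw [show i - P.n + 1 = i + 1 - P.n by omega] at this
      simpa [show ¬ i < P.n by omega, show ¬ i + 1 < P.n by omega] using this
  tag_mem i hi := by
    rcases lt_trichotomy (i + 1) P.n with h | h | h
    · simpa [h, show i < P.n by omega] using P.tag_mem i (by omega)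
    · have := P.tag_mem i (by omega)
      rw [h, P.s_last] at this
      simpa [h, show i < P.n by omega, Q.s_first] using this
    · have := Q.tag_mem (i - P.n) (by omega)
      rw [show i - P.n + 1 = i + 1 - P.n by omega] at this
      simpa [show ¬ i < P.n by omega, show ¬ i + 1 < P.n by omega] using this

variable {a b c : ℝ}

theorem append_s_left (P : TaggedPartition a b) (Q : TaggedPartition b c) {i : ℕ}
    (hi : i ≤ P.n) : (P.append Q).s i = P.s i := by
  rcases hi.lt_or_eq with h | rfl
  · simp [append, h]
  · simp [append, Q.s_first, P.s_last]

theorem append_s_right (P : TaggedPartition a b) (Q : TaggedPartition b c) (i : ℕ) :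
    (P.append Q).s (P.n + i) = Q.s i := by
  simp [append]

theorem append_tag_left (P : TaggedPartition a b) (Q : TaggedPartition b c) {i : ℕ}
    (hi : i < P.n) : (P.append Q).τ i = P.τ i := by
  simp [append, hi]

theorem append_tag_right (P : TaggedPartition a b) (Q : TaggedPartition b c) (i : ℕ) :
    (P.append Q).τ (P.n + i) = Q.τ i := by
  simp [append]

theorem IsFine.append {P : TaggedPartition a b} {Q : TaggedPartition b c} {δ : ℝ → ℝ}
    (hP : P.IsFine δ) (hQ : Q.IsFine δ) : (P.append Q).IsFine δ := by
  intro i hi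
  by_cases h : i < P.n
  · rw [append_s_left P Q h.le, append_s_left P Q h, append_tag_left P Q h]
    exact hP i h
  · obtain ⟨j, rfl⟩ := Nat.exists_eq_add_of_le (not_lt.1 h)
    rw [append_s_right, add_assoc, append_s_right, append_tag_right]
    exact hQ j (Nat.lt_of_add_lt_add_left hi)

theorem IsFine.mono {P : TaggedPartition a b} {δ δ' : ℝ → ℝ} (hP : P.IsFine δ)
    (h : ∀ t, δ t ≤ δ' t) : P.IsFine δ' := fun i hi =>
  (hP i hi).trans (Set.Ioo_subset_Ioo (by linarith [h (P.τ i)]) (by linarith [h (P.τ i)]))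

theorem single_isFine {t : ℝ} (ht : t ∈ Set.Icc a b) {δ : ℝ → ℝ}
    (h : Set.Icc a b ⊆ Set.Ioo (t - δ t) (t + δ t)) : (single t ht).IsFine δ := by
  intro i hi
  obtain rfl : i = 0 := Nat.lt_one_iff.1 hi
  simpa [single] using h

variable {E : Type*} [NormedAddCommGroup E] [NormedSpace ℝ E]

theorem sum_append (P : TaggedPartition a b) (Q : TaggedPartition b c) (f : ℝ → E)
    (g : ℝ → ℝ) : (P.append Q).sum f g = P.sum f g + Q.sum f g := by
  rw [TaggedPartition.sum, show (P.append Q).n = P.n + Q.n from rfl, Finset.sum_range_add]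
  congr 1
  · refine Finset.sum_congr rfl fun i hi => ?_
    have hi := Finset.mem_range.1 hi
    rw [append_s_left P Q hi.le, append_s_left P Q hi, append_tag_left P Q hi]
  · refine Finset.sum_congr rfl fun i _ => ?_
    rw [append_s_right, add_assoc, append_s_right, append_tag_right]

theorem sum_single {t : ℝ} (ht : t ∈ Set.Icc a b) (f : ℝ → E) (g : ℝ → ℝ) :
    (single t ht).sum f g = (g b - g a) • f t := by
  simp [TaggedPartition.sum, single]

/-- Cousin's lemma. -/
theorem exists_isFine (hab : a ≤ b) {δ : ℝ → ℝ} (hδ : ∀ t, 0 < δ t) :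
    ∃ P : TaggedPartition a b, P.IsFine δ := by
  let S : Set ℝ := {t | t ∈ Set.Icc a b ∧ ∃ P : TaggedPartition a t, P.IsFine δ}
  have haS : a ∈ S := ⟨⟨le_rfl, hab⟩, single a ⟨le_rfl, le_rfl⟩, single_isFine _ fun u hu => by
    have := hδ a
    exact ⟨by linarith [hu.1], by linarith [hu.2]⟩⟩
  have hbdd : BddAbove S := ⟨b, fun t ht => ht.1.2⟩
  set c := sSup S
  have hac : a ≤ c := le_csSup hbdd haS
  have hcb : c ≤ b := csSup_le ⟨a, haS⟩ fun t ht => ht.1.2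
  have hδc := hδ c
  have hcS : c ∈ S := by
    obtain ⟨t, ht, htc⟩ := exists_lt_of_lt_csSup ⟨a, haS⟩ (show c - δ c < sSup S by linarith)
    have htc' : t ≤ c := le_csSup hbdd ht
    obtain ⟨P, hP⟩ := ht.2
    exact ⟨⟨hac, hcb⟩, P.append (single c ⟨htc', le_rfl⟩), hP.append <| single_isFine _
      fun u hu => ⟨by linarith [hu.1], by linarith [hu.2]⟩⟩
  obtain ⟨P, hP⟩ := hcS.2
  rcases hcb.lt_or_eq with hlt | heq
  · set d := min b (c + δ c / 2)
    have hcd : c < d := lt_min hlt (by linarith)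
    have hdc : d ≤ c + δ c / 2 := min_le_right _ _
    have hdS : d ∈ S := ⟨⟨hac.trans hcd.le, min_le_left _ _⟩,
      P.append (single c ⟨le_rfl, hcd.le⟩), hP.append <| single_isFine _
        fun u hu => ⟨by linarith [hu.1], by linarith [hu.2]⟩⟩
    exact absurd (le_csSup hbdd hdS) (not_le.2 hcd)
  · exact heq ▸ ⟨P, hP⟩

end TaggedPartition

section IndefiniteIntegral

open TaggedPartition

variable {E : Type*} [NormedAddCommGroup E] [NormedSpace ℝ E]

/-- Henstock's lemma for one interval: the increment of the indefinite integral over a short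
interval is approximated by the corresponding term of a Riemann sum. -/
theorem exists_gauge_norm_increment_sub_lt {F : ℝ → E} {g : ℝ → ℝ} {a b : ℝ} {I : ℝ → E}
    (hab : a ≤ b) (hI : ∀ t ∈ Set.Icc a b, HasKSIntegral F g a t (I t)) {ε : ℝ} (hε : 0 < ε) :
    ∃ δ : ℝ → ℝ, (∀ t, 0 < δ t) ∧ ∀ u v t, a ≤ u → v ≤ b → t ∈ Set.Icc u v →
      Set.Icc u v ⊆ Set.Ioo (t - δ t) (t + δ t) →
      ‖I v - I u - (g v - g u) • F t‖ < ε := by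
  obtain ⟨δ, hδ, hδI⟩ := hI b ⟨hab, le_rfl⟩ (ε / 4) (by positivity)
  refine ⟨δ, hδ, fun u v t hau hvb ht hsub => ?_⟩
  have huv : u ≤ v := ht.1.trans ht.2
  have key : ∀ w ∈ Set.Icc a b, ∃ P : TaggedPartition a w,
      P.IsFine δ ∧ ‖P.sum F g - I w‖ < ε / 4 := by
    intro w hw
    obtain ⟨δ', hδ', hδI'⟩ := hI w hw (ε / 4) (by positivity)
    obtain ⟨P, hP⟩ := exists_isFine hw.1 (δ := fun s => min (δ s) (δ' s))
      fun s => lt_min (hδ s) (hδ' s)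
    exact ⟨P, hP.mono fun s => min_le_left _ _, hδI' P (hP.mono fun s => min_le_right _ _)⟩
  obtain ⟨P, hP, hPI⟩ := key u ⟨hau, huv.trans hvb⟩
  obtain ⟨Q, hQ, hQI⟩ := key v ⟨hau.trans huv, hvb⟩
  obtain ⟨R, hR⟩ := exists_isFine hvb hδ
  have h₁ := hδI _ ((hP.append (single_isFine ht hsub)).append hR)
  have h₂ := hδI _ (hQ.append hR)
  rw [sum_append, sum_append, sum_single] at h₁
  rw [sum_append] at h₂
  calc ‖I v - I u - (g v - g u) • F t‖
      = ‖((P.sum F g - I u) - (Q.sum F g - I v))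
          + ((Q.sum F g + R.sum F g - I b)
            - (P.sum F g + (g v - g u) • F t + R.sum F g - I b))‖ := by
        congr 1; abel
    _ ≤ (‖P.sum F g - I u‖ + ‖Q.sum F g - I v‖) + (‖Q.sum F g + R.sum F g - I b‖
          + ‖P.sum F g + (g v - g u) • F t + R.sum F g - I b‖) :=
        (norm_add_le _ _).trans (add_le_add (norm_sub_le _ _) (norm_sub_le _ _))
    _ < ε := by linarith

/-- The indefinite Kurzweil–Stieltjes integral with respect to a continuous integrator is
continuous. -/
theorem continuousOn_of_hasKSIntegral {F : ℝ → E} {g : ℝ → ℝ} {a b : ℝ} {I : ℝ → E}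
    (hg : ContinuousOn g (Set.Icc a b))
    (hI : ∀ t ∈ Set.Icc a b, HasKSIntegral F g a t (I t)) :
    ContinuousOn I (Set.Icc a b) := by
  intro t ht
  rw [ContinuousWithinAt, Metric.tendsto_nhds]
  intro ε hε
  obtain ⟨δ, hδ, H⟩ := exists_gauge_norm_increment_sub_lt (ht.1.trans ht.2) hI (half_pos hε)
  have hgF : ∀ᶠ s in 𝓝[Set.Icc a b] t, ‖(g s - g t) • F t‖ < ε / 2 := by
    have : Tendsto (fun s => ‖(g s - g t) • F t‖) (𝓝[Set.Icc a b] t) (𝓝 0) := by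
      simpa using (((hg t ht).tendsto.sub_const (g t)).smul_const (F t)).norm
    exact this.eventually_lt_const (half_pos hε)
  have hδt := hδ t
  filter_upwards [hgF, self_mem_nhdsWithin,
    nhdsWithin_le_nhds (Ioo_mem_nhds (sub_lt_self t hδt) (lt_add_of_pos_right t hδt))]
    with s hs hsab hsδ
  have hinc : ‖I s - I t - (g s - g t) • F t‖ < ε / 2 := by
    rcases le_total t s with hts | hst
    · exact H t s t ht.1 hsab.2 ⟨le_rfl, hts⟩ fun u hu =>
        ⟨by linarith [hu.1], hu.2.trans_lt hsδ.2⟩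
    · have := H s t t hsab.1 ht.2 ⟨hst, le_rfl⟩ fun u hu =>
        ⟨hsδ.1.trans_le hu.1, by linarith [hu.2]⟩
      rwa [← norm_neg, show -(I s - I t - (g s - g t) • F t) = I t - I s - (g t - g s) • F t by
        rw [← neg_sub (g s) (g t), neg_smul]; abel]
  rw [dist_eq_norm]
  calc ‖I s - I t‖ = ‖(I s - I t - (g s - g t) • F t) + (g s - g t) • F t‖ := by
        rw [sub_add_cancel]
    _ ≤ _ := norm_add_le _ _
    _ < ε := by linarith

end IndefiniteIntegral

section Perturbation

variable {E : Type*} [NormedAddCommGroup E]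

/-- If `h` is a nonlinear contraction in the second variable and `s ↦ x s - h s (x s)` is
continuous within `A` at `t`, then so is `x`, provided that it has a limit there. -/
theorem continuousWithinAt_of_sub_nonlinear_contraction {h : ℝ → E → E} {x : ℝ → E}
    {φ : ℝ → ℝ → ℝ} {A : Set ℝ} {t : ℝ}
    (hφD : ∀ r : ℝ, 0 ≤ r → IsDFunction (fun s => φ s r))
    (hφlt : ∀ r : ℝ, 0 ≤ r → ∀ s : ℝ, 0 < s → φ s r < s)
    (hh : ∀ v, ContinuousWithinAt (fun s => h s v) A t)
    (hlip : ∀ r : ℝ, 0 ≤ r → ∀ s ∈ insert t A, ∀ u v : E,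
      ‖u‖ ≤ r → ‖v‖ ≤ r → ‖h s u - h s v‖ ≤ φ ‖u - v‖ r)
    (hx : ContinuousWithinAt (fun s => x s - h s (x s)) A t)
    (hlim : ∃ L, Tendsto x (𝓝[A] t) (𝓝 L)) : ContinuousWithinAt x A t := by
  obtain ⟨L, hL⟩ := hlim
  rcases (𝓝[A] t).eq_or_neBot with hbot | hne
  · simp [ContinuousWithinAt, hbot]
  have hdiff : Tendsto (fun s => h s (x s) - h s L) (𝓝[A] t) (𝓝 0) := by
    have hr : 0 ≤ ‖L‖ + 1 := by positivity
    obtain ⟨hcont, -, hzero, -⟩ := hφD _ hr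
    have hnorm : Tendsto (fun s => ‖x s - L‖) (𝓝[A] t) (𝓝[Set.Ici 0] 0) :=
      tendsto_nhdsWithin_iff.2 ⟨by simpa using (hL.sub_const L).norm,
        Eventually.of_forall fun s => norm_nonneg _⟩
    have hφ : Tendsto (fun s => φ ‖x s - L‖ (‖L‖ + 1)) (𝓝[A] t) (𝓝 0) := by
      simpa only [hzero, Function.comp_def] using (hcont 0 Set.self_mem_Ici).tendsto.comp hnorm
    refine squeeze_zero_norm' ?_ hφ
    filter_upwards [self_mem_nhdsWithin,
      hL.norm.eventually_lt_const (lt_add_one ‖L‖)] with s hsA hs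
    exact hlip _ hr s (Set.mem_insert_of_mem _ hsA) _ _ hs.le (by linarith)
  have hhL : Tendsto (fun s => h s (x s)) (𝓝[A] t) (𝓝 (h t L)) := by
    simpa using hdiff.add (hh L).tendsto
  have heq : L - h t L = x t - h t (x t) := tendsto_nhds_unique (hL.sub hhL) hx.tendsto
  suffices hLx : L = x t by rwa [hLx] at hL
  by_contra hLx
  have hpos : 0 < ‖L - x t‖ := norm_pos_iff.2 (sub_ne_zero.2 hLx)
  have hr : 0 ≤ max ‖L‖ ‖x t‖ := (norm_nonneg L).trans (le_max_left _ _)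
  have hle := hlip _ hr t (Set.mem_insert _ _) L (x t) (le_max_left _ _) (le_max_right _ _)
  rw [← sub_eq_sub_iff_sub_eq_sub.1 heq] at hle
  exact (hφlt _ hr _ hpos).not_ge hle

end Perturbation

/-- Proposition 4.1: under (A1), (A2), (A3*), with `g` continuous and
`h(·,v)` continuous, every solution of the HMDE is continuous. -/
theorem continuity_of_solutions
    {n : ℕ} (t₀ a : ℝ) (ha : 0 < a)
    (g : ℝ → ℝ) (hg_mono : MonotoneOn g (Set.Icc t₀ (t₀ + a)))
    (hg_cont : ContinuousOn g (Set.Icc t₀ (t₀ + a)))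
    (f h : ℝ → En n → En n)
    (A1 : ∀ u : En n, KSIntegrable (fun s => f s u) g t₀ (t₀ + a))
    (M : ℝ → ℝ)
    (hM_nonneg : ∀ s ∈ Set.Icc t₀ (t₀ + a), 0 ≤ M s)
    (hM_int : KSIntegrable M g t₀ (t₀ + a))
    (A2 : ∀ (u : En n) (c d : ℝ), t₀ ≤ c → c ≤ d → d ≤ t₀ + a →
      ∀ (If : En n) (Im : ℝ), HasKSIntegral (fun s => f s u) g c d If →
        HasKSIntegral M g c d Im → ‖If‖ ≤ Im)
    (φ : ℝ → ℝ → ℝ)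
    (hφD : ∀ r : ℝ, 0 ≤ r → IsDFunction (fun t => φ t r))
    (hφlt : ∀ r : ℝ, 0 ≤ r → ∀ t : ℝ, 0 < t → φ t r < t)
    (A3cont : ∀ v : En n, ContinuousOn (fun t => h t v) (Set.Icc t₀ (t₀ + a)))
    (A3lip : ∀ r : ℝ, 0 ≤ r → ∀ t ∈ Set.Icc t₀ (t₀ + a), ∀ u v : En n,
      ‖u‖ ≤ r → ‖v‖ ≤ r → ‖h t u - h t v‖ ≤ φ ‖u - v‖ r)
    (x₀ : En n) (x : ℝ → En n)
    (hx : IsHMDESolution h f g t₀ a x₀ x) :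
    ContinuousOn x (Set.Icc t₀ (t₀ + a)) := by
  obtain ⟨hreg, -, -, I, hI, hxI⟩ := hx
  have hIcont := continuousOn_of_hasKSIntegral hg_cont hI
  have hsub : ContinuousOn (fun s => x s - h s (x s)) (Set.Icc t₀ (t₀ + a)) := by
    refine (hIcont.const_add (x₀ - h t₀ x₀)).congr fun s hs => ?_
    dsimp only
    nth_rewrite 1 [hxI s hs]
    abel
  intro t ht
  have hside : ∀ A ⊆ Set.Icc t₀ (t₀ + a), (∃ L, Tendsto x (𝓝[A] t) (𝓝 L)) →
      ContinuousWithinAt x A t := fun A hA hlim =>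
    continuousWithinAt_of_sub_nonlinear_contraction hφD hφlt
      (fun v => (A3cont v t ht).mono hA)
      (fun r hr s hs => A3lip r hr s (Set.insert_subset ht hA hs))
      ((hsub t ht).mono hA) hlim
  have hleft : ContinuousWithinAt x (Set.Ico t₀ t) t := by
    rcases ht.1.eq_or_lt with rfl | hlt
    · simp [ContinuousWithinAt]
    · exact hside _ (fun s hs => ⟨hs.1, hs.2.le.trans ht.2⟩) (hreg.1 t ⟨hlt, ht.2⟩)
  have hright : ContinuousWithinAt x (Set.Ioc t (t₀ + a)) t := by
    rcases ht.2.eq_or_lt with heq | hlt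
    · simp [ContinuousWithinAt, heq]
    · exact hside _ (fun s hs => ⟨ht.1.trans hs.1.le, hs.2⟩) (hreg.2 t ⟨ht.1, hlt⟩)
  refine ((hleft.union hright).insert).mono fun s hs => ?_
  rcases lt_trichotomy s t with hst | rfl | hst
  · exact Or.inr (Or.inl ⟨hs.1, hst⟩)
  · exact Or.inl rfl
  · exact Or.inr (Or.inr ⟨hst, hs.2⟩)

end HMDEPaper
end

section
/- Let J = [t₀, t₀ + a] with a > 0, let g : J → ℝ be nondecreasing, left-continuous and continuous, let f : J × ℝⁿ → ℝⁿ be continuous and satisfy conditions (A1) and (A2), and let h : J × ℝⁿ → ℝⁿ be continuously differentiable and satisfy condition (A3*). Let x : J → ℝⁿ be a solution of the hybrid measure differential equation on J with data (h, f, g, x₀), and assume that the matrix I − J_x h(t, x(t)) is invertible for every t ∈ J, where J_x h denotes the Jacobian matrix of h with respect to its second variable. Then: (a) x is differentiable at Lebesgue-almost every t ∈ J; (b) for each t ∈ [t₀, t₀ + a) at which the right derivative g′₊(t) exists, the right derivative x′₊(t) also exists, and for each t ∈ (t₀, t₀ + a] at which the left derivative g′₋(t) exists, the left derivative x′₋(t)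 also exists. -/
open Set Filter Topology

namespace HMDEPaper

section KurzweilStieltjes

/-- Induction along `δ`-fine tagged intervals (Cousin's lemma). -/
theorem cousin_induction {δ : ℝ → ℝ} (hδ : ∀ t, 0 < δ t) {p : ℝ → Prop} {a b : ℝ} (hab : a ≤ b)
    (ha : p a)
    (step : ∀ d e τ, a ≤ d → e ≤ b → τ ∈ Icc d e → Icc d e ⊆ Ioo (τ - δ τ) (τ + δ τ) →
      p d → p e) : p b := by
  set S : Set ℝ := {c | c ∈ Icc a b ∧ p c}
  have haS : a ∈ S := ⟨⟨le_rfl, hab⟩, ha⟩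
  have hbdd : BddAbove S := ⟨b, fun c hc => hc.1.2⟩
  set c := sSup S
  have hcb : c ≤ b := csSup_le ⟨a, haS⟩ fun c hc => hc.1.2
  have hδc := hδ c
  obtain ⟨d, hdS, hd⟩ := exists_lt_of_lt_csSup ⟨a, haS⟩ (show c - δ c < sSup S by linarith)
  have hdc : d ≤ c := le_csSup hbdd hdS
  have hce : c ≤ min b (c + δ c / 2) := le_min hcb (by linarith)
  have hpe : p (min b (c + δ c / 2)) := by
    refine step d _ c hdS.1.1 (min_le_left _ _) ⟨hdc, hce⟩ (fun r hr => ⟨by linarith [hr.1], ?_⟩)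
      hdS.2
    have := hr.2.trans (min_le_right _ _)
    linarith
  have hec : min b (c + δ c / 2) ≤ c :=
    le_csSup hbdd ⟨⟨hdS.1.1.trans (hdc.trans hce), min_le_left _ _⟩, hpe⟩
  rcases min_choice b (c + δ c / 2) with h | h
  · rwa [h] at hpe
  · rw [h] at hec
    linarith

/-- The one-interval tagged partition of a degenerate interval. -/
def TaggedPartition.point (a : ℝ) : TaggedPartition a a where
  n := 1
  npos := one_pos
  s := fun _ => a
  τ := fun _ => a
  s_first := rfl
  s_last := rfl
  s_mono := fun _ _ => le_rfl
  tag_mem := fun _ _ => ⟨le_rfl, le_rfl⟩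

theorem TaggedPartition.point_isFine {δ : ℝ → ℝ} (hδ : ∀ t, 0 < δ t) (a : ℝ) :
    (TaggedPartition.point a).IsFine δ := by
  intro i _ r hr
  have hr' : r ∈ Icc a a := hr
  rw [Icc_self, mem_singleton_iff] at hr'
  have := hδ a
  change r ∈ Ioo (a - δ a) (a + δ a)
  rw [hr']
  constructor <;> linarith

variable {E : Type*} [NormedAddCommGroup E] [NormedSpace ℝ E]

/-- A fine tagged partition can be extended by a fine tagged interval. -/
theorem TaggedPartition.IsFine.exists_extend {δ : ℝ → ℝ} {a d e τ : ℝ} {P : TaggedPartition a d}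
    (hP : P.IsFine δ) (hτ : τ ∈ Icc d e) (hfine : Icc d e ⊆ Ioo (τ - δ τ) (τ + δ τ))
    (F : ℝ → E) (g : ℝ → ℝ) :
    ∃ Q : TaggedPartition a e, Q.IsFine δ ∧ Q.sum F g = P.sum F g + (g e - g d) • F τ := by
  have hs : ∀ i, i ≤ P.n → (if i ≤ P.n then P.s i else e) = P.s i := fun i hi => if_pos hi
  have hτ' : ∀ i, i < P.n → (if i < P.n then P.τ i else τ) = P.τ i := fun i hi => if_pos hi
  have hlast : ∀ i, i < P.n + 1 → ¬ i < P.n → i = P.n := fun i h1 h2 => by omega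
  refine ⟨⟨P.n + 1, Nat.succ_pos _, fun i => if i ≤ P.n then P.s i else e,
    fun i => if i < P.n then P.τ i else τ, ?_, ?_, ?_, ?_⟩, ?_, ?_⟩
  · simpa using P.s_first
  · simp
  · intro i hi
    by_cases h : i < P.n
    · simpa only [hs i h.le, hs (i + 1) h] using P.s_mono i h
    · obtain rfl := hlast i hi h
      simpa [P.s_last] using hτ.1.trans hτ.2
  · intro i hi
    by_cases h : i < P.n
    · simpa only [hs i h.le, hs (i + 1) h, hτ' i h] using P.tag_mem i h
    · obtain rfl := hlast i hi h
      simpa [P.s_last] using hτ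
  · intro i hi
    by_cases h : i < P.n
    · simpa only [hs i h.le, hs (i + 1) h, hτ' i h] using hP i h
    · obtain rfl := hlast i hi h
      simpa [P.s_last] using hfine
  · unfold TaggedPartition.sum
    rw [Finset.sum_range_succ]
    congr 1
    · refine Finset.sum_congr rfl fun i hi => ?_
      have h := Finset.mem_range.1 hi
      simp only [hs i h.le, hs (i + 1) h, hτ' i h]
    · simp [P.s_last]

theorem HasKSIntegral.norm_sub_sub_smul_le {F : ℝ → E} {g : ℝ → ℝ} {a s t K : ℝ} {Is It v : E}
    (hs : HasKSIntegral F g a s Is) (ht : HasKSIntegral F g a t It) (has : a ≤ s) (hst : s ≤ t)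
    (hg : MonotoneOn g (Icc s t)) (hF : ∀ τ ∈ Icc s t, ‖F τ - v‖ ≤ K) :
    ‖It - Is - (g t - g s) • v‖ ≤ K * (g t - g s) := by
  refine le_of_forall_pos_le_add fun ε hε => ?_
  obtain ⟨δ₁, hδ₁, H₁⟩ := hs (ε / 2) (half_pos hε)
  obtain ⟨δ₂, hδ₂, H₂⟩ := ht (ε / 2) (half_pos hε)
  set δ : ℝ → ℝ := fun r => min (δ₁ r) (δ₂ r)
  have hδ : ∀ r, 0 < δ r := fun r => lt_min (hδ₁ r) (hδ₂ r)
  have hmono : ∀ {c : ℝ} {P : TaggedPartition a c} {δ' : ℝ → ℝ}, (∀ r, δ r ≤ δ' r) →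
      P.IsFine δ → P.IsFine δ' := fun hle hP i hi =>
    (hP i hi).trans (Ioo_subset_Ioo (sub_le_sub_left (hle _) _) (add_le_add_right (hle _) _))
  obtain ⟨P, hP⟩ : ∃ P : TaggedPartition a s, P.IsFine δ := by
    refine cousin_induction (p := fun c => ∃ P : TaggedPartition a c, P.IsFine δ) hδ has
      ⟨_, TaggedPartition.point_isFine hδ a⟩ ?_
    rintro d e τ - - hτ hfine ⟨P, hP⟩
    obtain ⟨Q, hQ, -⟩ := hP.exists_extend hτ hfine F g
    exact ⟨Q, hQ⟩
  obtain ⟨-, Q, hQ, hQP⟩ : s ≤ t ∧ ∃ Q : TaggedPartition a t, Q.IsFine δ ∧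
      ‖Q.sum F g - P.sum F g - (g t - g s) • v‖ ≤ K * (g t - g s) := by
    refine cousin_induction (p := fun c => s ≤ c ∧ ∃ Q : TaggedPartition a c, Q.IsFine δ ∧
      ‖Q.sum F g - P.sum F g - (g c - g s) • v‖ ≤ K * (g c - g s)) hδ hst
      ⟨le_rfl, P, hP, by simp⟩ ?_
    rintro d e τ hsd het hτ hfine ⟨-, Q, hQ, hQP⟩
    obtain ⟨R, hR, hRQ⟩ := hQ.exists_extend hτ hfine F g
    have hde : d ≤ e := hτ.1.trans hτ.2
    refine ⟨hsd.trans hde, R, hR, ?_⟩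
    have hgde : 0 ≤ g e - g d :=
      sub_nonneg.2 (hg ⟨hsd, hde.trans het⟩ ⟨hsd.trans hde, het⟩ hde)
    have heq : R.sum F g - P.sum F g - (g e - g s) • v =
        (Q.sum F g - P.sum F g - (g d - g s) • v) + (g e - g d) • (F τ - v) := by
      rw [hRQ]
      module
    calc _ ≤ K * (g d - g s) + (g e - g d) * K := by
          rw [heq]
          refine (norm_add_le _ _).trans (add_le_add hQP ?_)
          rw [norm_smul, Real.norm_of_nonneg hgde]
          exact mul_le_mul_of_nonneg_left (hF τ ⟨hsd.trans hτ.1, hτ.2.trans het⟩) hgde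
      _ = K * (g e - g s) := by ring
  have h₁ := H₁ P (hmono (fun r => min_le_left _ _) hP)
  have h₂ := H₂ Q (hmono (fun r => min_le_right _ _) hQ)
  have heq : It - Is - (g t - g s) • v = (Q.sum F g - P.sum F g - (g t - g s) • v)
      + ((P.sum F g - Is) - (Q.sum F g - It)) := by abel
  rw [heq]
  have h₃ := norm_add_le (Q.sum F g - P.sum F g - (g t - g s) • v)
    ((P.sum F g - Is) - (Q.sum F g - It))
  have h₄ := norm_sub_le (P.sum F g - Is) (Q.sum F g - It)
  linarith

/-- An indefinite integral is approximated by multiples of the increments of the integrator. -/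
theorem norm_integral_sub_sub_smul_le_uIcc {F I : ℝ → E} {g : ℝ → ℝ} {a b s t K : ℝ} {v : E}
    (hI : ∀ t ∈ Icc a b, HasKSIntegral F g a t (I t)) (hg : MonotoneOn g (Icc a b))
    (hs : s ∈ Icc a b) (ht : t ∈ Icc a b) (hF : ∀ τ ∈ uIcc s t, ‖F τ - v‖ ≤ K) :
    ‖I s - I t - (g s - g t) • v‖ ≤ K * |g s - g t| := by
  rcases le_total s t with hst | hst
  · rw [uIcc_of_le hst] at hF
    have := (hI s hs).norm_sub_sub_smul_le (hI t ht) hs.1 hst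
      (hg.mono (Icc_subset_Icc hs.1 ht.2)) hF
    rw [abs_of_nonpos (sub_nonpos.2 (hg hs ht hst)), neg_sub]
    convert this using 1
    rw [← norm_neg]
    congr 1
    module
  · rw [uIcc_of_ge hst] at hF
    have := (hI t ht).norm_sub_sub_smul_le (hI s hs) ht.1 hst
      (hg.mono (Icc_subset_Icc ht.1 hs.2)) hF
    rwa [abs_of_nonneg (sub_nonneg.2 (hg ht hs hst))]

theorem eventually_forall_uIcc {S : Set ℝ} (hS : S.OrdConnected) {t : ℝ} (ht : t ∈ S)
    {p : ℝ → Prop} (hp : ∀ᶠ s in 𝓝[S] t, p s) : ∀ᶠ s in 𝓝[S] t, ∀ τ ∈ uIcc s t, p τ := by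
  obtain ⟨η, hη, H⟩ := Metric.mem_nhdsWithin_iff.1 hp
  filter_upwards [inter_mem_nhdsWithin S (Metric.ball_mem_nhds t hη)] with s hs τ hτ
  exact H (((convex_ball t η).ordConnected.inter hS).uIcc_subset ⟨hs.2, hs.1⟩
    ⟨Metric.mem_ball_self hη, ht⟩ hτ)

theorem continuousWithinAt_integral {F I : ℝ → E} {g : ℝ → ℝ} {a b t : ℝ} {S : Set ℝ} {L : E}
    (hI : ∀ t ∈ Icc a b, HasKSIntegral F g a t (I t)) (hg : MonotoneOn g (Icc a b))
    (hgc : ContinuousOn g (Icc a b)) (hSJ : S ⊆ Icc a b) (hS : S.OrdConnected) (ht : t ∈ S)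
    (hF : Tendsto F (𝓝[S \ {t}] t) (𝓝 L)) : ContinuousWithinAt I S t := by
  have hbdd : ∀ᶠ s in 𝓝[S] t, ‖F s - 0‖ ≤ max (‖L‖ + 1) ‖F t‖ := by
    rw [← insert_eq_of_mem ht, ← insert_sdiff_singleton, nhdsWithin_insert, eventually_sup]
    refine ⟨by simp, ?_⟩
    filter_upwards [hF.norm.eventually_le_const (lt_add_one ‖L‖)] with s hs
    rw [sub_zero]
    exact hs.trans (le_max_left _ _)
  have hlim : Tendsto (fun s => max (‖L‖ + 1) ‖F t‖ * |g s - g t|) (𝓝[S] t) (𝓝 0) := by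
    have h₁ : Tendsto g (𝓝[S] t) (𝓝 (g t)) := (hgc t (hSJ ht)).mono hSJ
    simpa using ((h₁.sub_const (g t)).abs).const_mul (max (‖L‖ + 1) ‖F t‖)
  rw [ContinuousWithinAt, tendsto_iff_norm_sub_tendsto_zero]
  refine squeeze_zero' (Eventually.of_forall fun _ => norm_nonneg _) ?_ hlim
  filter_upwards [eventually_forall_uIcc hS ht hbdd, self_mem_nhdsWithin] with s hs hsS
  simpa using norm_integral_sub_sub_smul_le_uIcc hI hg (hSJ hsS) (hSJ ht) hs

theorem hasDerivWithinAt_integral {F I : ℝ → E} {g : ℝ → ℝ} {a b t d : ℝ} {S : Set ℝ}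
    (hI : ∀ t ∈ Icc a b, HasKSIntegral F g a t (I t)) (hg : MonotoneOn g (Icc a b))
    (hSJ : S ⊆ Icc a b) (hS : S.OrdConnected) (ht : t ∈ S) (hF : ContinuousWithinAt F S t)
    (hd : HasDerivWithinAt g d S t) : HasDerivWithinAt I (d • F t) S t := by
  have hsmul := hd.smul_const (F t)
  have ho : (fun s => I s - I t - (g s - g t) • F t) =o[𝓝[S] t] fun s => g s - g t := by
    refine Asymptotics.isLittleO_iff.2 fun ε hε => ?_
    have hnear : ∀ᶠ s in 𝓝[S] t, ‖F s - F t‖ ≤ ε :=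
      (tendsto_iff_norm_sub_tendsto_zero.1 hF).eventually_le_const hε
    filter_upwards [eventually_forall_uIcc hS ht hnear, self_mem_nhdsWithin] with s hs hsS
    exact norm_integral_sub_sub_smul_le_uIcc hI hg (hSJ hsS) (hSJ ht) hs
  have ho' := ho.trans_isBigO hd.differentiableWithinAt.isBigO_sub
  rw [hasDerivWithinAt_iff_isLittleO] at hsmul ⊢
  refine (ho'.add hsmul).congr_left fun s => ?_
  module

end KurzweilStieltjes

/-- A continuous function defined implicitly by `x s - h s (x s) = y s` is differentiable wherever
`y` is, provided `1 - ∂₂h` is injective there. -/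
theorem exists_hasDerivWithinAt_of_sub_eq {E : Type*} [NormedAddCommGroup E] [NormedSpace ℝ E]
    [FiniteDimensional ℝ E] {h : ℝ → E → E} (hh : ContDiff ℝ 1 (Function.uncurry h))
    {x y : ℝ → E} {S : Set ℝ} {t : ℝ} (ht : t ∈ S) (hx : ContinuousWithinAt x S t)
    (hxy : ∀ s ∈ S, x s - h s (x s) = y s)
    (hinj : Function.Injective (ContinuousLinearMap.id ℝ E - fderiv ℝ (h t) (x t)))
    {y' : E} (hy : HasDerivWithinAt y y' S t) : ∃ x', HasDerivWithinAt x x' S t := by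
  have : CompleteSpace E := FiniteDimensional.complete ℝ E
  set h' := fderiv ℝ (Function.uncurry h) (t, x t)
  have hh' : HasStrictFDerivAt (Function.uncurry h) h' (t, x t) :=
    hh.contDiffAt.hasStrictFDerivAt one_ne_zero
  have hpartial : fderiv ℝ (h t) (x t) = h'.comp (ContinuousLinearMap.inr ℝ ℝ E) :=
    (hh'.hasFDerivAt.comp (x t) (hasFDerivAt_prodMk_right t (x t))).fderiv
  set G : ℝ × E → ℝ × E := fun p => (p.1, p.2 - Function.uncurry h p)
  set G' : (ℝ × E) →L[ℝ] (ℝ × E) :=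
    (ContinuousLinearMap.fst ℝ ℝ E).prod (ContinuousLinearMap.snd ℝ ℝ E - h')
  have hG : HasStrictFDerivAt G G' (t, x t) :=
    hasStrictFDerivAt_fst.prodMk (hasStrictFDerivAt_snd.sub hh')
  have hG'inj : Function.Injective G' := by
    refine (injective_iff_map_eq_zero G').2 ?_
    rintro ⟨r, u⟩ hru
    obtain ⟨hr, hu⟩ := Prod.mk.inj (show (r, u - h' (r, u)) = ((0 : ℝ), (0 : E)) from hru)
    subst hr
    have hu0 : u = 0 := by
      refine (injective_iff_map_eq_zero _).1 hinj u ?_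
      rw [hpartial]
      simpa using hu
    rw [hu0]
    rfl
  set e := ContinuousLinearEquiv.ofBijective G' (LinearMap.ker_eq_bot.2 hG'inj)
    (LinearMap.range_eq_top.2 (LinearMap.injective_iff_surjective.1 hG'inj))
  have he : HasStrictFDerivAt G (e : (ℝ × E) →L[ℝ] (ℝ × E)) (t, x t) := by
    rwa [ContinuousLinearEquiv.coe_ofBijective]
  have hpair : ∀ s ∈ S, G (s, x s) = (s, y s) := fun s hs => Prod.ext rfl (hxy s hs)
  have hinv : HasFDerivAt (he.localInverse G e _) (e.symm : (ℝ × E) →L[ℝ] (ℝ × E)) (t, y t) := by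
    simpa only [hpair t ht] using he.to_localInverse.hasFDerivAt
  have hcomp := hinv.comp_hasDerivWithinAt t ((hasDerivWithinAt_id t S).prodMk hy)
  have hcont : Tendsto (fun s => (s, x s)) (𝓝[S] t) (𝓝 (t, x t)) :=
    continuousWithinAt_id.prodMk hx
  have hleft : ∀ s, G (s, x s) = (s, y s) →
      he.localInverse G e _ (G (s, x s)) = (s, x s) →
      x s = (he.localInverse G e _ (s, y s)).2 := fun s h1 h2 => by rw [← h1, h2]
  refine ⟨_, (hasFDerivAt_snd.comp_hasDerivWithinAt t hcomp).congr_of_eventuallyEq ?_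
    (hleft t (hpair t ht) he.eventually_left_inverse.self_of_nhds)⟩
  filter_upwards [hcont.eventually he.eventually_left_inverse, self_mem_nhdsWithin] with s hs hsS
  exact hleft s (hpair s hsS) hs

/-- Two solutions of `u - k u = c` agree if `k` is a nonlinear contraction. -/
theorem eq_of_sub_eq_sub {E : Type*} [NormedAddCommGroup E] {k : E → E} {ψ : ℝ → ℝ} {u v : E}
    (hψ : ∀ r, 0 < r → ψ r < r) (hk : ‖k u - k v‖ ≤ ψ ‖u - v‖) (huv : u - k u = v - k v) :
    u = v := by
  by_contra hne
  have hpos : 0 < ‖u - v‖ := norm_pos_iff.2 (sub_ne_zero.2 hne)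
  have heq : u - v = k u - k v := by
    rw [sub_eq_sub_iff_sub_eq_sub] at huv
    exact huv
  have := hψ _ hpos
  rw [← heq] at hk
  linarith

/-- Proposition 4.2, parts (a) and (b): differentiability of solutions. -/
theorem differentiability_of_solutions_ae_and_one_sided
    {n : ℕ} (t₀ a : ℝ) (ha : 0 < a)
    (g : ℝ → ℝ) (hg_mono : MonotoneOn g (Set.Icc t₀ (t₀ + a)))
    (hg_lc : LeftContinuousOn g t₀ (t₀ + a))
    (hg_cont : ContinuousOn g (Set.Icc t₀ (t₀ + a)))
    (f h : ℝ → En n → En n)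
    (hf_cont : Continuous (Function.uncurry f))
    (A1 : ∀ u : En n, KSIntegrable (fun s => f s u) g t₀ (t₀ + a))
    (M : ℝ → ℝ)
    (hM_nonneg : ∀ s ∈ Set.Icc t₀ (t₀ + a), 0 ≤ M s)
    (hM_int : KSIntegrable M g t₀ (t₀ + a))
    (A2 : ∀ (u : En n) (c d : ℝ), t₀ ≤ c → c ≤ d → d ≤ t₀ + a →
      ∀ (If : En n) (Im : ℝ), HasKSIntegral (fun s => f s u) g c d If →
        HasKSIntegral M g c d Im → ‖If‖ ≤ Im)
    (hh_smooth : ContDiff ℝ 1 (Function.uncurry h))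
    (φ : ℝ → ℝ → ℝ)
    (hφD : ∀ r : ℝ, 0 ≤ r → IsDFunction (fun t => φ t r))
    (hφlt : ∀ r : ℝ, 0 ≤ r → ∀ t : ℝ, 0 < t → φ t r < t)
    (A3reg : ∀ v : En n, RegulatedOn (fun t => h t v) t₀ (t₀ + a))
    (A3lip : ∀ r : ℝ, 0 ≤ r → ∀ t ∈ Set.Icc t₀ (t₀ + a), ∀ u v : En n,
      ‖u‖ ≤ r → ‖v‖ ≤ r → ‖h t u - h t v‖ ≤ φ ‖u - v‖ r)
    (x₀ : En n) (x : ℝ → En n)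
    (hx : IsHMDESolution h f g t₀ a x₀ x)
    (hinv : ∀ t ∈ Set.Icc t₀ (t₀ + a),
      Function.Bijective (ContinuousLinearMap.id ℝ (En n) - fderiv ℝ (h t) (x t))) :
    (∀ᵐ t ∂(MeasureTheory.volume.restrict (Set.Icc t₀ (t₀ + a))),
        DifferentiableWithinAt ℝ x (Set.Icc t₀ (t₀ + a)) t) ∧
    (∀ t ∈ Set.Ico t₀ (t₀ + a),
      (∃ d : ℝ, HasDerivWithinAt g d (Set.Icc t (t₀ + a)) t) →
      ∃ d' : En n, HasDerivWithinAt x d' (Set.Icc t (t₀ + a)) t) ∧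
    (∀ t ∈ Set.Ioc t₀ (t₀ + a),
      (∃ d : ℝ, HasDerivWithinAt g d (Set.Icc t₀ t) t) →
      ∃ d' : En n, HasDerivWithinAt x d' (Set.Icc t₀ t) t) := by
  obtain ⟨hxreg, -, -, I, hI, hxI⟩ := hx
  set J := Icc t₀ (t₀ + a)
  have hxy : ∀ s ∈ J, x s - h s (x s) = x₀ - h t₀ x₀ + I s := fun s hs => by
    rw [sub_eq_iff_eq_add]
    exact (hxI s hs).trans (by abel)
  have hcont_of_tendsto : ∀ S ⊆ J, S.OrdConnected → ∀ t ∈ S, ∀ L,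
      Tendsto x (𝓝[S \ {t}] t) (𝓝 L) → ContinuousWithinAt x S t := by
    intro S hSJ hS t ht L hL
    rw [← continuousWithinAt_sdiff_self]
    rcases eq_or_neBot (𝓝[S \ {t}] t) with hbot | _
    · rw [ContinuousWithinAt, hbot]
      exact tendsto_bot
    have hpair : Tendsto (fun s => (s, x s)) (𝓝[S \ {t}] t) (𝓝 (t, L)) :=
      (tendsto_id.mono_left nhdsWithin_le_nhds).prodMk_nhds hL
    have hIcont := continuousWithinAt_integral hI hg_mono hg_cont hSJ hS ht
      ((hf_cont.tendsto (t, L)).comp hpair)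
    have hlim₁ : Tendsto (fun s => x s - h s (x s)) (𝓝[S \ {t}] t) (𝓝 (L - h t L)) :=
      hL.sub ((hh_smooth.continuous.tendsto (t, L)).comp hpair)
    have hlim₂ : Tendsto (fun s => x s - h s (x s)) (𝓝[S \ {t}] t) (𝓝 (x t - h t (x t))) := by
      rw [hxy t (hSJ ht)]
      refine ((hIcont.mono sdiff_subset).tendsto.const_add (x₀ - h t₀ x₀)).congr' ?_
      filter_upwards [self_mem_nhdsWithin] with s hs
      exact (hxy s (hSJ hs.1)).symm
    have hr : 0 ≤ max ‖L‖ ‖x t‖ := (norm_nonneg _).trans (le_max_left _ _)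
    have hLx : L = x t := eq_of_sub_eq_sub (hφlt _ hr)
      (A3lip _ hr t (hSJ ht) L (x t) (le_max_left _ _) (le_max_right _ _))
      (tendsto_nhds_unique hlim₁ hlim₂)
    rwa [hLx] at hL
  have hxcont : ContinuousOn x J := by
    intro t ht
    have hleft : ContinuousWithinAt x (Icc t₀ t) t := by
      rcases eq_or_lt_of_le ht.1 with rfl | hlt
      · rw [Icc_self]
        exact continuousWithinAt_singleton
      · obtain ⟨L, hL⟩ := hxreg.1 t ⟨hlt, ht.2⟩
        refine hcont_of_tendsto _ (Icc_subset_Icc_right ht.2) ordConnected_Icc t ⟨ht.1, le_rfl⟩ L ?_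
        rwa [Icc_sdiff_right]
    have hright : ContinuousWithinAt x (Icc t (t₀ + a)) t := by
      rcases eq_or_lt_of_le ht.2 with heq | hlt
      · rw [← heq, Icc_self]
        exact continuousWithinAt_singleton
      · obtain ⟨L, hL⟩ := hxreg.2 t ⟨ht.1, hlt⟩
        refine hcont_of_tendsto _ (Icc_subset_Icc_left ht.1) ordConnected_Icc t ⟨le_rfl, ht.2⟩ L ?_
        rwa [Icc_sdiff_left]
    exact (hleft.union hright).mono (Icc_union_Icc_eq_Icc ht.1 ht.2).ge
  have hderiv : ∀ S ⊆ J, S.OrdConnected → ∀ t ∈ S, (∃ d, HasDerivWithinAt g d S t) →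
      ∃ d', HasDerivWithinAt x d' S t := by
    rintro S hSJ hS t ht ⟨d, hd⟩
    have hxt : ContinuousWithinAt x S t := (hxcont t (hSJ ht)).mono hSJ
    have hF : ContinuousWithinAt (fun s => f s (x s)) S t :=
      hf_cont.continuousAt.comp_continuousWithinAt (continuousWithinAt_id.prodMk hxt)
    exact exists_hasDerivWithinAt_of_sub_eq hh_smooth ht hxt (fun s hs => hxy s (hSJ hs))
      (hinv t (hSJ ht)).injective
      ((hasDerivWithinAt_integral hI hg_mono hSJ hS ht hF hd).const_add _)
  refine ⟨?_, fun t ht => ?_, fun t ht => ?_⟩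
  · filter_upwards [hg_mono.ae_differentiableWithinAt measurableSet_Icc,
      MeasureTheory.ae_restrict_mem measurableSet_Icc] with t hgt ht
    obtain ⟨d', hd'⟩ := hderiv J subset_rfl ordConnected_Icc t ht ⟨_, hgt.hasDerivWithinAt⟩
    exact hd'.differentiableWithinAt
  · exact hderiv _ (Icc_subset_Icc_left ht.1) ordConnected_Icc t ⟨le_rfl, ht.2.le⟩
  · exact hderiv _ (Icc_subset_Icc_right ht.2) ordConnected_Icc t ⟨ht.1.le, le_rfl⟩

end HMDEPaper
end

section
/- Let ω > 0 and let x : [0,∞) → ℝⁿ be S-asymptotically ω-periodic. Let p : [0,∞) × ℝⁿ → ℝⁿ be uniformly S-asymptotically ω-periodic on bounded sets, and assume p satisfies: for every v ∈ ℝⁿ the function p(·,v) is bounded and regulated on [0,∞), and there is φ : [0,∞) × [0,∞) → [0,∞) such that for every r ≥ 0, φ(·,r) is a D-function with φ(t,r) < t for t > 0, and ‖p(t,u) − p(t,v)‖ ≤ φ(‖u − v‖, r) for all u, v ∈ ℝⁿ with ‖u‖, ‖v‖ ≤ r and all t ≥ 0. Then the function t ↦ p(t, x(t)) is S-asymptotically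 ω-periodic. -/
open Set Filter Topology

namespace HMDEPaper

/-- If each `p t` with `t ≥ 0` is nonexpansive and `x → L`, `p · L → M` along a filter living on
`[0, ∞)`, then `p t (x t) → M`. -/
theorem tendsto_comp_of_nonexpansive {E F : Type*} [NormedAddCommGroup E] [NormedAddCommGroup F]
    {p : ℝ → E → F} (hp : ∀ t : ℝ, 0 ≤ t → ∀ u v : E, ‖p t u - p t v‖ ≤ ‖u - v‖)
    {x : ℝ → E} {l : Filter ℝ} (hl : ∀ᶠ t in l, 0 ≤ t) {L : E} {M : F}
    (hx : Tendsto x l (𝓝 L)) (hpL : Tendsto (fun t => p t L) l (𝓝 M)) :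
    Tendsto (fun t => p t (x t)) l (𝓝 M) := by
  have hdiff : Tendsto (fun t => p t (x t) - p t L) l (𝓝 0) :=
    squeeze_zero_norm' (hl.mono fun t ht => hp t ht (x t) L)
      (tendsto_iff_norm_sub_tendsto_zero.1 hx)
  simpa using hdiff.add hpL

/-- Lemma 4.1: composition of an S-asymptotically `ω`-periodic function with a
uniformly S-asymptotically `ω`-periodic (on bounded sets) function satisfying (A3*) is
S-asymptotically `ω`-periodic. -/
theorem sap_composition
    {n : ℕ} (ω : ℝ) (hω : 0 < ω)
    (x : ℝ → En n) (hx : SAsympPeriodic ω x)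
    (p : ℝ → En n → En n)
    (hp_reg : ∀ v : En n, RegulatedOnIci (fun t => p t v) ∧
      ∃ C : ℝ, ∀ t : ℝ, 0 ≤ t → ‖p t v‖ ≤ C)
    (hp_cont : ∀ t : ℝ, 0 ≤ t → Continuous (p t))
    (hp_unif : ∀ r : ℝ, 0 < r → ∀ ε : ℝ, 0 < ε → ∃ T : ℝ, 0 < T ∧
      ∀ t : ℝ, T ≤ t → ∀ u : En n, ‖u‖ ≤ r → ‖p (t + ω) u - p t u‖ ≤ ε)
    (φ : ℝ → ℝ → ℝ)
    (hφD : ∀ r : ℝ, 0 ≤ r → IsDFunction (fun t => φ t r))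
    (hφlt : ∀ r : ℝ, 0 ≤ r → ∀ t : ℝ, 0 < t → φ t r < t)
    (hp_lip : ∀ r : ℝ, 0 ≤ r → ∀ t : ℝ, 0 ≤ t → ∀ u v : En n,
      ‖u‖ ≤ r → ‖v‖ ≤ r → ‖p t u - p t v‖ ≤ φ ‖u - v‖ r) :
    SAsympPeriodic ω (fun t => p t (x t)) := by
  have hp : ∀ t : ℝ, 0 ≤ t → ∀ u v : En n, ‖p t u - p t v‖ ≤ ‖u - v‖ := by
    intro t ht u v
    have hr : 0 ≤ max ‖u‖ ‖v‖ := le_max_of_le_left (norm_nonneg u)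
    refine (hp_lip _ hr t ht u v (le_max_left _ _) (le_max_right _ _)).trans ?_
    rcases (norm_nonneg (u - v)).eq_or_lt with h | h
    · rw [← h]
      exact (hφD _ hr).2.2.1.le
    · exact (hφlt _ hr _ h).le
  obtain ⟨⟨C, hC⟩, ⟨hleft, hright⟩, hper⟩ := hx
  refine ⟨?_, ⟨?_, ?_⟩, ?_⟩
  · obtain ⟨K, hK⟩ := (hp_reg 0).2
    refine ⟨C + K, fun t ht => ?_⟩
    have h := hp t ht (x t) 0
    rw [sub_zero] at h
    linarith [norm_le_norm_sub_add (p t (x t)) (p t 0), hC t ht, hK t ht]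
  · intro t ht
    obtain ⟨L, hL⟩ := hleft t ht
    obtain ⟨M, hM⟩ := (hp_reg L).1.1 t ht
    exact ⟨M, tendsto_comp_of_nonexpansive hp
      (eventually_mem_nhdsWithin.mono fun s hs => hs.1) hL hM⟩
  · intro t ht
    obtain ⟨L, hL⟩ := hright t ht
    obtain ⟨M, hM⟩ := (hp_reg L).1.2 t ht
    exact ⟨M, tendsto_comp_of_nonexpansive hp
      (eventually_mem_nhdsWithin.mono fun s hs => ht.trans (le_of_lt hs)) hL hM⟩
  · rw [Metric.tendsto_atTop] at hper ⊢
    intro ε hε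
    obtain ⟨N, hN⟩ := hper (ε / 2) (half_pos hε)
    obtain ⟨T, hT, hpT⟩ := hp_unif (max C 1) (by positivity) (ε / 2) (half_pos hε)
    refine ⟨max N T, fun t ht => ?_⟩
    have htT : T ≤ t := (le_max_right _ _).trans ht
    have ht0 : 0 ≤ t := hT.le.trans htT
    have hxt := hN t ((le_max_left _ _).trans ht)
    have hpt := hpT t htT (x t) ((hC t ht0).trans (le_max_left _ _))
    have hpx := hp (t + ω) (by linarith) (x (t + ω)) (x t)
    rw [dist_zero_right] at hxt ⊢
    linarith [norm_sub_le_norm_sub_add_norm_sub (p (t + ω) (x (t + ω))) (p (t + ω) (x t))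
      (p t (x t))]

end HMDEPaper
end

section
/- Let X be a Banach space, ω > 0, and let (y_k)_k be a sequence of S-asymptotically ω-periodic functions [0,∞) → X that is uniformly bounded (sup_k sup_{t≥0} ‖y_k(t)‖ < ∞) and uniformly S-asymptotically ω-periodic, i.e., for every ε > 0 there is T_ε > 0 such that ‖y_k(t+ω) − y_k(t)‖ ≤ ε for all t ≥ T_ε and all k. Assume y : [0,∞) → X is such that y_k → y as k → ∞ uniformly on every bounded subinterval of [0,∞). Then y is bounded, regulated, and S-asymptotically ω-periodic. -/
open Set Filter Topology

namespace HMDEPaper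

/-- A limit of functions that is uniform on a set belonging to the filter `l` has a limit
along `l` as soon as all the approximating functions do. -/
theorem exists_tendsto_of_tendstoUniformlyOn {ι α β : Type*} [UniformSpace β] [CompleteSpace β]
    {p : Filter ι} [p.NeBot] {l : Filter α} [l.NeBot] {F : ι → α → β} {f : α → β} {s : Set α}
    (hF : TendstoUniformlyOn F f p s) (hs : s ∈ l) (hlim : ∀ i, ∃ L, Tendsto (F i) l (𝓝 L)) :
    ∃ L, Tendsto f l (𝓝 L) := by
  refine cauchy_map_iff_exists_tendsto.1 (cauchy_map_iff'.2 fun U hU => ?_)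
  obtain ⟨V, hV, hVsymm, hVU⟩ := comp_comp_symm_mem_uniformity_sets hU
  obtain ⟨i, hi⟩ := (hF V hV).exists
  have hcauchy := cauchy_map_iff'.1 (cauchy_map_iff_exists_tendsto.2 (hlim i)) hV
  rw [mem_map] at hcauchy ⊢
  filter_upwards [hcauchy, prod_mem_prod hs hs] with q hq hqs
  exact hVU ⟨F i q.2, ⟨F i q.1, hi _ hqs.1, hq⟩, SetRel.symm V (hi _ hqs.2)⟩

/-- Regulatedness on `[0, ∞)` passes to limits uniform on bounded subintervals. -/
theorem RegulatedOnIci.of_tendstoUniformlyOn {X : Type*} [NormedAddCommGroup X] [CompleteSpace X]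
    {y : ℕ → ℝ → X} {ylim : ℝ → X} (hy : ∀ k, RegulatedOnIci (y k))
    (hconv : ∀ b : ℝ, 0 < b → TendstoUniformlyOn y ylim atTop (Icc 0 b)) :
    RegulatedOnIci ylim := by
  refine ⟨fun t ht => ?_, fun t ht => ?_⟩
  · have : (𝓝[Ico 0 t] t).NeBot := by
      rw [nhdsWithin_Ico_eq_nhdsLT ht]
      infer_instance
    exact exists_tendsto_of_tendstoUniformlyOn (hconv t ht)
      (mem_of_superset self_mem_nhdsWithin Ico_subset_Icc_self) fun k => (hy k).1 t ht
  · refine exists_tendsto_of_tendstoUniformlyOn (hconv (t + 1) (by linarith)) ?_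
      fun k => (hy k).2 t ht
    filter_upwards [Ioo_mem_nhdsGT (lt_add_one t)] with u hu
    exact ⟨ht.trans hu.1.le, hu.2.le⟩

/-- Lemma 4.2: a uniformly bounded, uniformly S-asymptotically `ω`-periodic
sequence of S-asymptotically `ω`-periodic functions converging uniformly on bounded
intervals has an S-asymptotically `ω`-periodic limit. -/
theorem sap_of_uniform_limit
    {X : Type*} [NormedAddCommGroup X] [NormedSpace ℝ X] [CompleteSpace X]
    (ω : ℝ) (hω : 0 < ω)
    (y : ℕ → ℝ → X)
    (hSAP : ∀ k : ℕ, SAsympPeriodic ω (y k))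
    (hbdd : ∃ C : ℝ, ∀ k : ℕ, ∀ t : ℝ, 0 ≤ t → ‖y k t‖ ≤ C)
    (hunif : ∀ ε : ℝ, 0 < ε → ∃ T : ℝ, 0 < T ∧
      ∀ t : ℝ, T ≤ t → ∀ k : ℕ, ‖y k (t + ω) - y k t‖ ≤ ε)
    (ylim : ℝ → X)
    (hconv : ∀ b : ℝ, 0 < b →
      TendstoUniformlyOn (fun k => y k) ylim Filter.atTop (Set.Icc 0 b)) :
    SAsympPeriodic ω ylim := by
  have hpt : ∀ t : ℝ, 0 ≤ t → Tendsto (fun k => y k t) atTop (𝓝 (ylim t)) := fun t ht =>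
    (hconv (t + 1) (by linarith)).tendsto_at ⟨ht, by linarith⟩
  refine ⟨?_, .of_tendstoUniformlyOn (fun k => (hSAP k).2.1) hconv, ?_⟩
  · obtain ⟨C, hC⟩ := hbdd
    exact ⟨C, fun t ht => le_of_tendsto (hpt t ht).norm (.of_forall fun k => hC k t ht)⟩
  · refine Metric.tendsto_nhds.2 fun ε hε => ?_
    obtain ⟨T, hT, hyT⟩ := hunif (ε / 2) (half_pos hε)
    filter_upwards [eventually_ge_atTop T] with t ht
    rw [dist_zero_right]
    exact (le_of_tendsto ((hpt (t + ω) (by linarith)).sub (hpt t (by linarith))).norm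
      (.of_forall fun k => hyT t ht k)).trans_lt (half_lt_self hε)

end HMDEPaper
end
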